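/- Let Q be a finite quiver and σ : P_{i_1}^{⊕u_1}⊕… → P_{j_1}^{⊕w_1}⊕… a morphism of projective ℂQ-modules whose evaluation matrix M_σ(m) at m ∈ rep_Q(α) is square. Then the function d_σ(m) = det(M_σ(m)) is a polynomial function on the affine space rep_Q(α), and for g ∈ GL(α), d_σ(g·m) = χ(g) · d_σ(m) for some character χ of GL(α); i.e., d_σ is a semi-invariant. -/

import Mathlib

open Quiver

/-- The representation space of a quiver for a dimension vector α. -/
abbrev MRep (V : Type) [Quiver.{1} V] (α : V → ℕ) :=
  ∀ (i j : V), (i ⟶ j) → Matrix (Fin (α j)) (Fin (α i)) ℂ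

/-- Evaluation of an oriented path at a representation: the product of the matrices
attached to the arrows of the path. -/
noncomputable def evalPath {V : Type} [Quiver.{1} V] {α : V → ℕ} (m : MRep V α) :
    ∀ {x y : V}, Quiver.Path x y → Matrix (Fin (α y)) (Fin (α x)) ℂ
  | _, _, Quiver.Path.nil => 1
  | _, _, Quiver.Path.cons p a => m _ _ a * evalPath m p

/-- Evaluation of a ℂ-linear combination of paths (with fixed endpoints) at a
representation. -/
noncomputable def evalComb {V : Type} [Quiver.{1} V] {α : V → ℕ} (m : MRep V α) {x y : V}
    (c : Quiver.Path x y →₀ ℂ) : Matrix (Fin (α y)) (Fin (α x)) ℂ :=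
  c.sum fun p coeff => coeff • evalPath m p

/-- A morphism σ : ⊕ᵢ Pᵢ^{⊕ e i} → ⊕ⱼ Pⱼ^{⊕ f j} of projective left ℂQ-modules is given by a
matrix of linear combinations of paths; `evalσ σ m` is the matrix M_σ(m) obtained by
substituting the matrices of the representation m along each path. -/
noncomputable def evalσ {V : Type} [Quiver.{1} V] {α : V → ℕ} (e f : V → ℕ)
    (σ : ∀ (p : Σ i : V, Fin (e i)) (q : Σ j : V, Fin (f j)), Quiver.Path q.1 p.1 →₀ ℂ)
    (m : MRep V α) :
    Matrix ((p : Σ i : V, Fin (e i)) × Fin (α p.1)) ((q : Σ j : V, Fin (f j)) × Fin (α q.1)) ℂ :=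
  fun r c => evalComb m (σ r.1 c.1) r.2 c.2

/-- The base-change action of GL(α) on the representation space. -/
noncomputable def gAct {V : Type} [Quiver.{1} V] {α : V → ℕ} (g : ∀ i, GL (Fin (α i)) ℂ)
    (m : MRep V α) : MRep V α :=
  fun i j a => (g j : Matrix (Fin (α j)) (Fin (α j)) ℂ) * m i j a *
    (((g i)⁻¹ : GL (Fin (α i)) ℂ) : Matrix (Fin (α i)) (Fin (α i)) ℂ)


/-- The algebra of polynomial functions on the representation space. -/
noncomputable def polyAlg (V : Type) [Quiver.{1} V] (α : V → ℕ) : Subalgebra ℂ (MRep V α → ℂ) :=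
  (MvPolynomial.aeval (R := ℂ)
    (fun (x : (i : V) × (j : V) × (i ⟶ j) × (Fin (α j) × Fin (α i))) (m : MRep V α) =>
      m x.1 x.2.1 x.2.2.1 x.2.2.2.1 x.2.2.2.2)).range

theorem polyAlg_exists {V : Type} [Quiver.{1} V] {α : V → ℕ} {F : MRep V α → ℂ}
    (h : F ∈ polyAlg V α) :
    ∃ P : MvPolynomial ((i : V) × (j : V) × (i ⟶ j) × (Fin (α j) × Fin (α i))) ℂ,
      ∀ m : MRep V α,
        F m = MvPolynomial.eval (fun x => m x.1 x.2.1 x.2.2.1 x.2.2.2.1 x.2.2.2.2) P := by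
  obtain ⟨P, hP⟩ := h
  refine ⟨P, fun m => ?_⟩
  rw [← hP]
  change Pi.evalAlgHom ℂ (fun _ : MRep V α => ℂ) m (MvPolynomial.aeval _ P) = _
  rw [← AlgHom.comp_apply, MvPolynomial.comp_aeval, ← MvPolynomial.coe_aeval_eq_eval]
  rfl

theorem entry_mem {V : Type} [Quiver.{1} V] {α : V → ℕ} {i j : V} (a : i ⟶ j)
    (r : Fin (α j)) (c : Fin (α i)) : (fun m : MRep V α => m i j a r c) ∈ polyAlg V α :=
  ⟨MvPolynomial.X ⟨i, j, a, r, c⟩, by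
    change MvPolynomial.aeval _ _ = _
    rw [MvPolynomial.aeval_X]⟩

theorem const_mem_polyAlg {V : Type} [Quiver.{1} V] {α : V → ℕ} (z : ℂ) :
    (fun _ : MRep V α => z) ∈ polyAlg V α :=
  (polyAlg V α).algebraMap_mem z

theorem sum_mem_polyAlg {V : Type} [Quiver.{1} V] {α : V → ℕ} {ι : Type*} (s : Finset ι)
    (F : ι → MRep V α → ℂ) (h : ∀ i ∈ s, F i ∈ polyAlg V α) :
    (fun m => ∑ i ∈ s, F i m) ∈ polyAlg V α := by
  have := (polyAlg V α).sum_mem h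
  convert this using 1
  ext m; simp

theorem prod_mem_polyAlg {V : Type} [Quiver.{1} V] {α : V → ℕ} {ι : Type*} (s : Finset ι)
    (F : ι → MRep V α → ℂ) (h : ∀ i ∈ s, F i ∈ polyAlg V α) :
    (fun m => ∏ i ∈ s, F i m) ∈ polyAlg V α := by
  have := (polyAlg V α).prod_mem h
  convert this using 1
  ext m; simp

theorem evalPath_mem {V : Type} [Quiver.{1} V] {α : V → ℕ} {x y : V} (p : Quiver.Path x y) :
    ∀ (r : Fin (α y)) (c : Fin (α x)),
      (fun m : MRep V α => evalPath m p r c) ∈ polyAlg V α := by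
  induction p with
  | nil =>
    intro r c
    simp only [evalPath]
    exact const_mem_polyAlg _
  | cons p a ih =>
    intro r c
    simp only [evalPath, Matrix.mul_apply]
    exact sum_mem_polyAlg _ (fun k m => m _ _ a r k * evalPath m p k c)
      fun k _ => (polyAlg V α).mul_mem (entry_mem a r k) (ih k c)

theorem evalComb_mem {V : Type} [Quiver.{1} V] {α : V → ℕ} {x y : V}
    (z : Quiver.Path x y →₀ ℂ) (r : Fin (α y)) (c : Fin (α x)) :
    (fun m : MRep V α => evalComb m z r c) ∈ polyAlg V α := by
  simp only [evalComb, Finsupp.sum, Matrix.sum_apply, Matrix.smul_apply, smul_eq_mul]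
  exact sum_mem_polyAlg _ (fun p m => z p * evalPath m p r c)
    fun p _ => (polyAlg V α).mul_mem (const_mem_polyAlg _) (evalPath_mem p r c)

theorem evalPath_gAct {V : Type} [Quiver.{1} V] {α : V → ℕ} (g : ∀ i, GL (Fin (α i)) ℂ)
    (m : MRep V α) {x y : V} (p : Quiver.Path x y) :
    evalPath (gAct g m) p = (g y : Matrix (Fin (α y)) (Fin (α y)) ℂ) * evalPath m p *
      (((g x)⁻¹ : GL (Fin (α x)) ℂ) : Matrix (Fin (α x)) (Fin (α x)) ℂ) := by
  induction p with
  | nil => simp only [evalPath, Matrix.mul_one, Units.mul_inv]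
  | @cons b d p a ih =>
    simp only [evalPath, ih, gAct, Matrix.mul_assoc]
    rw [← Matrix.mul_assoc (((g b)⁻¹ : GL (Fin (α b)) ℂ) : Matrix (Fin (α b)) (Fin (α b)) ℂ) (g b : Matrix (Fin (α b)) (Fin (α b)) ℂ),
      Units.inv_mul, Matrix.one_mul]

theorem evalComb_gAct {V : Type} [Quiver.{1} V] {α : V → ℕ} (g : ∀ i, GL (Fin (α i)) ℂ)
    (m : MRep V α) {x y : V} (z : Quiver.Path x y →₀ ℂ) :
    evalComb (gAct g m) z = (g y : Matrix (Fin (α y)) (Fin (α y)) ℂ) * evalComb m z *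
      (((g x)⁻¹ : GL (Fin (α x)) ℂ) : Matrix (Fin (α x)) (Fin (α x)) ℂ) := by
  simp only [evalComb, Finsupp.sum, evalPath_gAct, Matrix.mul_sum, Matrix.sum_mul,
    Matrix.mul_smul, Matrix.smul_mul]

theorem evalσ_gAct {V : Type} [Quiver.{1} V] [Fintype V] [DecidableEq V] {α : V → ℕ} (e f : V → ℕ)
    (σ : ∀ (p : Σ i : V, Fin (e i)) (q : Σ j : V, Fin (f j)), Quiver.Path q.1 p.1 →₀ ℂ)
    (g : ∀ i, GL (Fin (α i)) ℂ) (m : MRep V α) :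
    evalσ e f σ (gAct g m) =
      Matrix.blockDiagonal' (fun p : Σ i : V, Fin (e i) =>
        (g p.1 : Matrix (Fin (α p.1)) (Fin (α p.1)) ℂ)) * evalσ e f σ m *
      Matrix.blockDiagonal' (fun q : Σ i : V, Fin (f i) =>
        (((g q.1)⁻¹ : GL (Fin (α q.1)) ℂ) : Matrix (Fin (α q.1)) (Fin (α q.1)) ℂ)) := by
  ext ⟨p, r⟩ ⟨q, c⟩
  have hL : ∀ (k : (q : Σ j : V, Fin (f j)) × Fin (α q.1)),
      (Matrix.blockDiagonal' (fun p : Σ i : V, Fin (e i) =>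
        (g p.1 : Matrix (Fin (α p.1)) (Fin (α p.1)) ℂ)) * evalσ e f σ m) ⟨p, r⟩ k =
      ((g p.1 : Matrix (Fin (α p.1)) (Fin (α p.1)) ℂ) * evalComb m (σ p k.1)) r k.2 := by
    intro k
    rw [Matrix.mul_apply, Fintype.sum_sigma, Finset.sum_eq_single p, Matrix.mul_apply]
    · simp only [Matrix.blockDiagonal'_apply_eq, evalσ]
    · intro b _ hb
      refine Finset.sum_eq_zero fun s _ => ?_
      rw [Matrix.blockDiagonal'_apply_ne _ _ _ (Ne.symm hb), zero_mul]
    · simp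
  rw [Matrix.mul_apply, Fintype.sum_sigma, Finset.sum_eq_single q]
  · simp only [hL, Matrix.blockDiagonal'_apply_eq]
    change evalComb (gAct g m) (σ p q) r c = _
    rw [evalComb_gAct, Matrix.mul_apply]
  · intro b _ hb
    refine Finset.sum_eq_zero fun s _ => ?_
    rw [Matrix.blockDiagonal'_apply_ne _ _ _ hb, mul_zero]
  · simp

/-- Determinant of a block diagonal matrix with blocks of varying sizes. -/
theorem det_blockDiag_var {o : Type*} [Fintype o] [DecidableEq o] {n : o → Type*}
    [∀ i, Fintype (n i)] [∀ i, DecidableEq (n i)] (M : ∀ i, Matrix (n i) (n i) ℂ) :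
    (Matrix.blockDiagonal' M).det = ∏ i, (M i).det := by
  letI : LinearOrder o := LinearOrder.lift' (Fintype.equivFin o) (Fintype.equivFin o).injective
  have h : Matrix.BlockTriangular (Matrix.blockDiagonal' M) Sigma.fst :=
    fun i j hij => Matrix.blockDiagonal'_apply_ne M _ _ (ne_of_gt hij)
  rw [Matrix.BlockTriangular.det_fintype h]
  refine Finset.prod_congr rfl fun k _ => ?_
  let E : n k ≃ {x : Sigma n // x.1 = k} :=
    { toFun := fun x => ⟨⟨k, x⟩, rfl⟩
      invFun := fun x => x.2 ▸ x.1.2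
      left_inv := fun x => rfl
      right_inv := by rintro ⟨⟨k, x⟩, rfl⟩; rfl }
  rw [← Matrix.det_submatrix_equiv_self E]
  congr 1
  ext a b
  exact Matrix.blockDiagonal'_apply_eq M k a b

/-- The weight of `d_σ`. -/
noncomputable def weightChar {V : Type} [Fintype V] (α e f : V → ℕ) :
    (∀ i, GL (Fin (α i)) ℂ) →* ℂˣ :=
  (∏ p : (Σ i : V, Fin (e i)), Matrix.GeneralLinearGroup.det.comp
    (Pi.evalMonoidHom (fun i => GL (Fin (α i)) ℂ) p.1)) *
  (∏ q : (Σ i : V, Fin (f i)), Matrix.GeneralLinearGroup.det.comp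
    (Pi.evalMonoidHom (fun i => GL (Fin (α i)) ℂ) q.1))⁻¹

theorem weightChar_apply {V : Type} [Fintype V] (α e f : V → ℕ) (g : ∀ i, GL (Fin (α i)) ℂ) :
    (weightChar α e f g : ℂ) =
      (∏ p : (Σ i : V, Fin (e i)), (g p.1 : Matrix (Fin (α p.1)) (Fin (α p.1)) ℂ).det) *
      ∏ q : (Σ i : V, Fin (f i)),
        (((g q.1)⁻¹ : GL (Fin (α q.1)) ℂ) : Matrix (Fin (α q.1)) (Fin (α q.1)) ℂ).det := by
  have h : weightChar α e f g = (∏ p : (Σ i : V, Fin (e i)), Matrix.GeneralLinearGroup.det (g p.1)) *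
      ∏ q : (Σ i : V, Fin (f i)), Matrix.GeneralLinearGroup.det (g q.1)⁻¹ := by
    simp [weightChar]
  rw [h, Units.val_mul, Units.coe_prod, Units.coe_prod]
  rfl

/-- when M_σ(m) is square (witnessed by the bijection ε between its column and
row index sets), the function d_σ(m) = det M_σ(m) is a polynomial function on the affine
space rep_Q(α), and it is a semi-invariant for the base-change GL(α)-action: there is a
character χ of GL(α) with d_σ(g·m) = χ(g)·d_σ(m). -/
theorem dsigma_is_polynomial_semiinvariant {V : Type} [Quiver.{1} V] [Fintype V] [DecidableEq V]
    (α e f : V → ℕ)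
    (σ : ∀ (p : Σ i : V, Fin (e i)) (q : Σ j : V, Fin (f j)), Quiver.Path q.1 p.1 →₀ ℂ)
    (ε : ((q : Σ j : V, Fin (f j)) × Fin (α q.1)) ≃ ((p : Σ i : V, Fin (e i)) × Fin (α p.1))) :
    (∃ P : MvPolynomial ((i : V) × (j : V) × (i ⟶ j) × (Fin (α j) × Fin (α i))) ℂ,
      ∀ m : MRep V α,
        ((evalσ e f σ m).submatrix id ε.symm).det =
          MvPolynomial.eval (fun x => m x.1 x.2.1 x.2.2.1 x.2.2.2.1 x.2.2.2.2) P) ∧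
    (∃ χ : (∀ i, GL (Fin (α i)) ℂ) →* ℂˣ,
      ∀ (g : ∀ i, GL (Fin (α i)) ℂ) (m : MRep V α),
        ((evalσ e f σ (gAct g m)).submatrix id ε.symm).det =
          (χ g : ℂ) * ((evalσ e f σ m).submatrix id ε.symm).det) := by
  classical
  refine ⟨polyAlg_exists (F := fun m => ((evalσ e f σ m).submatrix id ε.symm).det) ?_,
    weightChar α e f, fun g m => ?_⟩
  · simp only [Matrix.det_apply']
    refine sum_mem_polyAlg _ _ fun τ _ => ?_
    refine (polyAlg V α).mul_mem (const_mem_polyAlg _) ?_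
    exact prod_mem_polyAlg _ _ fun k _ => evalComb_mem _ _ _
  · rw [evalσ_gAct, weightChar_apply,
      ← Matrix.submatrix_mul_equiv _ _ id ε.symm ε.symm,
      ← Matrix.submatrix_mul_equiv _ _ id (Equiv.refl _) ε.symm]
    rw [Matrix.det_mul, Matrix.det_submatrix_equiv_self, Equiv.coe_refl, Matrix.det_mul, Matrix.submatrix_id_id,
      det_blockDiag_var, det_blockDiag_var]
    ring
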